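/- arXiv:1904.02076 — 2 statements merged into one kernel-verified Lean document; each statement's English description precedes it below -/
import Mathlib

section
/- (Expected bandwidth, sparse regime) Let (n_k), (m_k), (e_k) be sequences of positive integers tending to infinity with e_k ≤ N_k := (n_k+1)(m_k+1) and e_k² / (n_k·m_k) → 0. Then the average of I(E) over all binom(N_k, e_k) error configurations E of the (n_k+1)×(m_k+1) grid with exactly e_k cells tends to 0 as k → ∞. -/
open Filter Topology

/-- A configuration `E` of cells in the `(n+1) × (m+1)` grid is *good* if every nonempty
subset of `E` contains a cell that is the unique cell of the subset in its row,
or the unique cell of the subset in its column. -/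
def IsGood (n m : ℕ) (E : Finset (Fin (n + 1) × Fin (m + 1))) : Prop :=
  ∀ E'' ⊆ E, E''.Nonempty →
    ∃ c ∈ E'', (∀ c' ∈ E'', c'.1 = c.1 → c' = c) ∨ (∀ c' ∈ E'', c'.2 = c.2 → c' = c)

/-- The coordinates graph of a configuration: the bipartite graph on rows ⊕ columns where
row `i` is adjacent to column `j` iff `(i, j) ∈ E`. -/
def coordGraph (n m : ℕ) (E : Finset (Fin (n + 1) × Fin (m + 1))) :
    SimpleGraph (Fin (n + 1) ⊕ Fin (m + 1)) :=
  SimpleGraph.fromRel (fun u v => ∃ i j, u = Sum.inl i ∧ v = Sum.inr j ∧ (i, j) ∈ E)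

/-- Total number of connected components of the coordinates graph (isolated vertices included). -/
noncomputable def Ncc (n m : ℕ) (E : Finset (Fin (n + 1) × Fin (m + 1))) : ℕ :=
  Nat.card (coordGraph n m E).ConnectedComponent

/-- Number of connected components of the coordinates graph containing at least one edge. -/
noncomputable def Nnscc (n m : ℕ) (E : Finset (Fin (n + 1) × Fin (m + 1))) : ℕ :=
  Set.ncard {c : (coordGraph n m E).ConnectedComponent |
    ∃ u v, (coordGraph n m E).Adj u v ∧ (coordGraph n m E).connectedComponentMk u = c}

/-- Number of rows containing at least one cell of `E`. -/
def rowCount (n m : ℕ) (E : Finset (Fin (n + 1) × Fin (m + 1))) : ℕ :=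
  (E.image Prod.fst).card

/-- Number of columns containing at least one cell of `E`. -/
def colCount (n m : ℕ) (E : Finset (Fin (n + 1) × Fin (m + 1))) : ℕ :=
  (E.image Prod.snd).card

/-- `I(E)`: minimum cardinality of a feedback repair set of `E`, i.e. of a subset
`E' ⊆ E` such that `E \ E'` is a good configuration. -/
noncomputable def minFRS (n m : ℕ) (E : Finset (Fin (n + 1) × Fin (m + 1))) : ℕ :=
  sInf {k | ∃ E' ⊆ E, IsGood n m (E \ E') ∧ E'.card = k}


def cycCells {n m : ℕ} (t : ℕ) (p : (Fin (t+2) → Fin (n+1)) × (Fin (t+2) → Fin (m+1))) :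
    Finset (Fin (n + 1) × Fin (m + 1)) :=
  Finset.univ.image (fun i => (p.1 i, p.2 i)) ∪ Finset.univ.image (fun i => (p.1 (i+1), p.2 i))

lemma cycCells_card {n m : ℕ} (t : ℕ) (p : (Fin (t+2) → Fin (n+1)) × (Fin (t+2) → Fin (m+1)))
    (h1 : Function.Injective p.1) (h2 : Function.Injective p.2) :
    (cycCells t p).card = 2 * (t+2) := by
  unfold cycCells
  rw [Finset.card_union_of_disjoint, Finset.card_image_of_injective, Finset.card_image_of_injective]
  · simp; ring
  · intro a b hab
    exact h2 (Prod.ext_iff.1 hab).2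
  · intro a b hab
    exact h2 (Prod.ext_iff.1 hab).2
  · rw [Finset.disjoint_left]
    intro x hx hy
    simp only [Finset.mem_image, Finset.mem_univ, true_and] at hx hy
    obtain ⟨a, rfl⟩ := hx
    obtain ⟨b, hb⟩ := hy
    have e1 := h1 (Prod.ext_iff.1 hb).1
    have e2 := h2 (Prod.ext_iff.1 hb).2
    subst e2
    simp at e1

lemma exists_cyc_of_seq {n m : ℕ} (E : Finset (Fin (n + 1) × Fin (m + 1)))
    (r : ℕ → Fin (n+1)) (c : ℕ → Fin (m+1)) (h1 : ∀ i, (r i, c i) ∈ E)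
    (h2 : ∀ i, (r (i+1), c i) ∈ E) (hr : ∀ i, r (i+1) ≠ r i) (hc : ∀ i, c (i+1) ≠ c i) :
    ∃ t, ∃ p : (Fin (t+2) → Fin (n+1)) × (Fin (t+2) → Fin (m+1)),
      Function.Injective p.1 ∧ Function.Injective p.2 ∧ cycCells t p ⊆ E := by
  classical
  have key : ∀ (a t : ℕ), (∀ i j, i < t+2 → j < t+2 → r (a+i) = r (a+j) → i = j) →
      (∀ i j, i < t+2 → j < t+2 → c (a+i) = c (a+j) → i = j) →
      (r a, c (a+t+1)) ∈ E →
      ∃ t, ∃ p : (Fin (t+2) → Fin (n+1)) × (Fin (t+2) → Fin (m+1)),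
      Function.Injective p.1 ∧ Function.Injective p.2 ∧ cycCells t p ⊆ E := by
    intro a t ir ic hl
    refine ⟨t, (fun i => r (a+i), fun i => c (a+i)), ?_, ?_, ?_⟩
    · intro i j hij
      exact Fin.ext (ir i j i.2 j.2 hij)
    · intro i j hij
      exact Fin.ext (ic i j i.2 j.2 hij)
    · intro x hx
      simp only [cycCells, Finset.mem_union, Finset.mem_image, Finset.mem_univ, true_and] at hx
      rcases hx with ⟨i, rfl⟩ | ⟨i, rfl⟩
      · exact h1 _
      · rcases Nat.lt_or_ge (i.1+1) (t+2) with hi | hi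
        · have : ((i+1 : Fin (t+2)) : ℕ) = i + 1 := by
            rw [Fin.val_add]; simp [Nat.mod_eq_of_lt hi]
          rw [this]
          exact h2 (a+i)
        · have hi' : i.1 = t+1 := by omega
          have : ((i+1 : Fin (t+2)) : ℕ) = 0 := by
            rw [Fin.val_add]; simp [hi']
          rw [this, hi']
          exact hl
  have hex : ∃ q, ∃ p < q, r p = r q ∨ c p = c q := by
    obtain ⟨a, b, hab, h⟩ := Finite.exists_ne_map_eq_of_infinite r
    rcases lt_or_gt_of_ne hab with hl | hl
    · exact ⟨b, a, hl, Or.inl h⟩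
    · exact ⟨a, b, hl, Or.inl h.symm⟩
  set q := Nat.find hex with hq
  obtain ⟨p, hp, hpq⟩ := Nat.find_spec hex
  rw [← hq] at hp hpq
  have hmin : ∀ x y, x < y → y < q → r x ≠ r y ∧ c x ≠ c y := by
    intro x y hxy hy
    have := Nat.find_min hex hy
    push Not at this
    exact this x hxy
  by_cases hA : ∃ p < q, r p = r q
  · obtain ⟨p, hp, hpq⟩ := hA
    have hne : q ≠ p + 1 := fun h => hr p (by rw [← h, hpq])
    obtain ⟨t, ht⟩ : ∃ t, q = p + t + 2 := ⟨q - p - 2, by omega⟩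
    · refine key p t ?_ ?_ ?_
      · intro i j hi hj h
        by_contra hij
        rcases lt_or_gt_of_ne hij with hl | hl
        · exact (hmin (p+i) (p+j) (by omega) (by omega)).1 h
        · exact (hmin (p+j) (p+i) (by omega) (by omega)).1 h.symm
      · intro i j hi hj h
        by_contra hij
        rcases lt_or_gt_of_ne hij with hl | hl
        · exact (hmin (p+i) (p+j) (by omega) (by omega)).2 h
        · exact (hmin (p+j) (p+i) (by omega) (by omega)).2 h.symm
      · rw [hpq, ht]; exact h2 _
  · push Not at hA
    have hpq : c p = c q := hpq.resolve_left (hA p hp)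
    have hne : q ≠ p + 1 := fun h => hc p (by rw [← h, hpq])
    have hR : ∀ x y, x < y → y ≤ q → r x ≠ r y := by
      intro x y hxy hy
      rcases hy.lt_or_eq with h | h
      · exact (hmin x y hxy h).1
      · subst h; exact hA x hxy
    have hC : ∀ x y, p < x → x < y → y ≤ q → c x ≠ c y := by
      intro x y hpx hxy hy
      rcases hy.lt_or_eq with h | h
      · exact (hmin x y hxy h).2
      · rw [h, ← hpq]
        exact (hmin p x hpx (by omega)).2.symm
    obtain ⟨t, ht⟩ : ∃ t, q = p + t + 2 := ⟨q - p - 2, by omega⟩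
    refine key (p+1) t ?_ ?_ ?_
    · intro i j hi hj h
      by_contra hij
      rcases lt_or_gt_of_ne hij with hl | hl
      · exact hR (p+1+i) (p+1+j) (by omega) (by omega) h
      · exact hR (p+1+j) (p+1+i) (by omega) (by omega) h.symm
    · intro i j hi hj h
      by_contra hij
      rcases lt_or_gt_of_ne hij with hl | hl
      · exact hC (p+1+i) (p+1+j) (by omega) (by omega) (by omega) h
      · exact hC (p+1+j) (p+1+i) (by omega) (by omega) (by omega) h.symm
    · rw [show p+1+t+1 = q by omega, ← hpq]; exact h2 _

lemma exists_cyc {n m : ℕ} (E : Finset (Fin (n + 1) × Fin (m + 1))) (hE : ¬ IsGood n m E) :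
    ∃ t, ∃ p : (Fin (t+2) → Fin (n+1)) × (Fin (t+2) → Fin (m+1)),
      Function.Injective p.1 ∧ Function.Injective p.2 ∧ cycCells t p ⊆ E := by
  unfold IsGood at hE
  push Not at hE
  obtain ⟨F, hF, ⟨x0, hx0⟩, h⟩ := hE
  have hh : ∀ x : F, ∃ y : F, y.1.1 = x.1.1 ∧ y.1 ≠ x.1 := by
    intro x
    obtain ⟨y, hy, h1, h2⟩ := (h x.1 x.2).1
    exact ⟨⟨y, hy⟩, h1, h2⟩
  have hv : ∀ x : F, ∃ y : F, y.1.2 = x.1.2 ∧ y.1 ≠ x.1 := by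
    intro x
    obtain ⟨y, hy, h1, h2⟩ := (h x.1 x.2).2
    exact ⟨⟨y, hy⟩, h1, h2⟩
  choose f hf1 hf2 using hh
  choose g hg1 hg2 using hv
  let x : ℕ → F := fun i => (fun y => f (g y))^[i] ⟨x0, hx0⟩
  have hx : ∀ i, x (i+1) = f (g (x i)) := fun i => Function.iterate_succ_apply' _ _ _
  refine exists_cyc_of_seq E (fun i => (x i).1.1) (fun i => (x i).1.2) ?_ ?_ ?_ ?_
  · intro i; exact hF (x i).2
  · intro i
    have : (((x (i+1)).1.1, (x i).1.2) : Fin (n + 1) × Fin (m + 1)) = (g (x i)).1 := by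
      ext1
      · simp [hx, hf1]
      · simp [hg1]
    simp only [this]
    exact hF (g (x i)).2
  · intro i hi
    simp only [hx, hf1] at hi
    exact hg2 _ (Prod.ext hi (hg1 _))
  · intro i hi
    simp only [hx] at hi
    exact hf2 (g (x i)) (Prod.ext (hf1 _) (hi.trans (hg1 _).symm))

open Classical in
lemma minFRS_le {n m : ℕ} (E : Finset (Fin (n + 1) × Fin (m + 1))) :
    minFRS n m E ≤ ∑ t ∈ Finset.range (n+1),
      (Finset.univ.filter (fun p : (Fin (t+2) → Fin (n+1)) × (Fin (t+2) → Fin (m+1)) =>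
        (Function.Injective p.1 ∧ Function.Injective p.2) ∧ cycCells t p ⊆ E)).card := by
  set E' := (Finset.range (n+1)).biUnion (fun t =>
      (Finset.univ.filter (fun p : (Fin (t+2) → Fin (n+1)) × (Fin (t+2) → Fin (m+1)) =>
        (Function.Injective p.1 ∧ Function.Injective p.2) ∧ cycCells t p ⊆ E)).image
        (fun p => (p.1 0, p.2 0))) with hE'
  have h0 : ∀ t (p : (Fin (t+2) → Fin (n+1)) × (Fin (t+2) → Fin (m+1))),
      (p.1 0, p.2 0) ∈ cycCells t p := by
    intro t p
    simp only [cycCells, Finset.mem_union, Finset.mem_image, Finset.mem_univ, true_and]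
    exact Or.inl ⟨0, rfl⟩
  have hsub : E' ⊆ E := by
    intro x hx
    simp only [hE', Finset.mem_biUnion, Finset.mem_image, Finset.mem_filter] at hx
    obtain ⟨t, -, p, ⟨-, -, hp⟩, rfl⟩ := hx
    exact hp (h0 t p)
  have hgood : IsGood n m (E \ E') := by
    by_contra hb
    obtain ⟨t, p, h1, h2, h3⟩ := exists_cyc _ hb
    have hm := h3 (h0 t p)
    rw [Finset.mem_sdiff] at hm
    apply hm.2
    have := Fintype.card_le_of_injective _ h1
    simp only [Fintype.card_fin] at this
    simp only [hE', Finset.mem_biUnion, Finset.mem_image, Finset.mem_filter]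
    exact ⟨t, Finset.mem_range.2 (by omega), p, ⟨Finset.mem_univ _, ⟨h1, h2⟩,
      h3.trans Finset.sdiff_subset⟩, rfl⟩
  calc minFRS n m E ≤ E'.card := Nat.sInf_le ⟨E', hsub, hgood, rfl⟩
    _ ≤ _ := Finset.card_biUnion_le
    _ ≤ _ := Finset.sum_le_sum fun t _ => Finset.card_image_le

lemma choose_bound (N e s : ℕ) (hs : s ≤ e) (he : e ≤ N) :
    (N - s).choose (e - s) * N ^ s ≤ N.choose e * e ^ s := by
  induction s with
  | zero => simp
  | succ s ih =>
    have ih := ih (by omega)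
    obtain ⟨a, ha⟩ : ∃ a, e = a + s + 1 := ⟨e - s - 1, by omega⟩
    obtain ⟨b, hb⟩ : ∃ b, N = b + s + 1 := ⟨N - s - 1, by omega⟩
    have e1 : N - (s+1) = b := by omega
    have e2 : e - (s+1) = a := by omega
    have e3 : N - s = b + 1 := by omega
    have e4 : e - s = a + 1 := by omega
    rw [e1, e2]
    rw [e3, e4] at ih
    have h := Nat.add_one_mul_choose_eq b a
    have h5 : N * (a+1) ≤ e * (b+1) := by
      have : a ≤ b := by omega
      rw [ha, hb]; nlinarith
    apply Nat.le_of_mul_le_mul_left _ (Nat.succ_pos b)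
    calc (b+1) * (b.choose a * N^(s+1)) = ((b+1) * b.choose a) * N^(s+1) := by ring
      _ = ((b+1).choose (a+1) * N^s) * (N * (a+1)) := by rw [h]; ring
      _ ≤ (N.choose e * e^s) * (e * (b+1)) := Nat.mul_le_mul ih h5
      _ = _ := by rw [Nat.succ_eq_add_one]; ring

lemma count_supersets {α : Type*} [Fintype α] [DecidableEq α] (S : Finset α) (e : ℕ)
    (he : e ≤ Fintype.card α) :
    (((Finset.powersetCard e (Finset.univ : Finset α)).filter (fun E => S ⊆ E)).card : ℕ)
      * (Fintype.card α) ^ S.card ≤ (Fintype.card α).choose e * e ^ S.card := by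
  by_cases hs : S.card ≤ e
  · refine le_trans (Nat.mul_le_mul_right _ ?_) (choose_bound _ e S.card hs he)
    have : (Fintype.card α - S.card).choose (e - S.card)
        = (Finset.powersetCard (e - S.card) Sᶜ).card := by
      rw [Finset.card_powersetCard, Finset.card_compl]
    rw [this]
    apply Finset.card_le_card_of_injOn (fun E => E \ S)
    · intro E hE
      simp only [Finset.coe_filter, Finset.mem_powersetCard, Set.mem_setOf_eq] at hE
      simp only [Finset.mem_coe, Finset.mem_powersetCard]
      refine ⟨?_, ?_⟩
      · intro x hx
        simp at hx ⊢
        exact hx.2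
      · rw [Finset.card_sdiff_of_subset hE.2, hE.1.2]
    · intro A hA B hB hab
      simp only [Finset.coe_filter, Finset.mem_powersetCard, Set.mem_setOf_eq] at hA hB
      simp only at hab
      rw [← Finset.sdiff_union_of_subset hA.2, ← Finset.sdiff_union_of_subset hB.2, hab]
  · rw [Finset.filter_eq_empty_iff.2]
    · simp
    · intro E hE hS
      rw [Finset.mem_powersetCard] at hE
      exact hs (hE.2 ▸ Finset.card_le_card hS)

lemma avg_bound (n m e : ℕ) (hle : e ≤ (n+1)*(m+1)) :
    (∑ E ∈ Finset.powersetCard e (Finset.univ : Finset (Fin (n + 1) × Fin (m + 1))),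
            (minFRS n m E : ℝ)) /
          (Nat.choose ((n + 1) * (m + 1)) e : ℝ) ≤
    ∑ t ∈ Finset.range (n+1), ((e:ℝ)^2 / ((n+1)*(m+1)))^(t+2) := by
  classical
  have hC : (0:ℝ) < (Nat.choose ((n + 1) * (m + 1)) e : ℝ) := by
    exact_mod_cast Nat.choose_pos hle
  rw [div_le_iff₀ hC]
  have hcard : Fintype.card (Fin (n + 1) × Fin (m + 1)) = (n+1)*(m+1) := by simp
  calc (∑ E ∈ Finset.powersetCard e (Finset.univ : Finset (Fin (n + 1) × Fin (m + 1))),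
            (minFRS n m E : ℝ))
      ≤ ∑ E ∈ Finset.powersetCard e (Finset.univ : Finset (Fin (n + 1) × Fin (m + 1))),
        ∑ t ∈ Finset.range (n+1),
        ∑ p : (Fin (t+2) → Fin (n+1)) × (Fin (t+2) → Fin (m+1)),
        if (Function.Injective p.1 ∧ Function.Injective p.2) ∧ cycCells t p ⊆ E then (1:ℝ) else 0 := by
        refine Finset.sum_le_sum fun E _ => ?_
        have := minFRS_le E
        refine le_trans (Nat.cast_le.2 this) ?_
        push_cast
        simp only [Finset.sum_boole, le_refl]
    _ = ∑ t ∈ Finset.range (n+1),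
        ∑ p : (Fin (t+2) → Fin (n+1)) × (Fin (t+2) → Fin (m+1)),
        ∑ E ∈ Finset.powersetCard e (Finset.univ : Finset (Fin (n + 1) × Fin (m + 1))),
        if (Function.Injective p.1 ∧ Function.Injective p.2) ∧ cycCells t p ⊆ E then (1:ℝ) else 0 := by
        rw [Finset.sum_comm]
        refine Finset.sum_congr rfl fun t _ => ?_
        rw [Finset.sum_comm]
    _ ≤ ∑ t ∈ Finset.range (n+1),
        ∑ p : (Fin (t+2) → Fin (n+1)) × (Fin (t+2) → Fin (m+1)),
        (Nat.choose ((n + 1) * (m + 1)) e : ℝ) * (e:ℝ)^(2*(t+2)) / ((n+1)*(m+1))^(2*(t+2)) := by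
        refine Finset.sum_le_sum fun t _ => Finset.sum_le_sum fun p _ => ?_
        by_cases hp : Function.Injective p.1 ∧ Function.Injective p.2
        · simp only [hp, and_self, true_and, Finset.sum_boole]
          rw [le_div_iff₀ (by positivity)]
          have := count_supersets (cycCells t p) e (by rw [hcard]; exact hle)
          rw [cycCells_card t p hp.1 hp.2, hcard] at this
          exact_mod_cast this
        · simp only [hp, false_and, if_false, Finset.sum_const_zero]
          positivity
    _ = _ := by
        rw [Finset.sum_mul]
        refine Finset.sum_congr rfl fun t _ => ?_
        simp only [Finset.sum_const, Finset.card_univ, Fintype.card_prod, Fintype.card_fun,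
          Fintype.card_fin, nsmul_eq_mul]
        push_cast
        rw [div_pow, pow_mul, pow_mul]
        have h1 : ((n:ℝ)+1) ≠ 0 := by positivity
        have h2 : ((m:ℝ)+1) ≠ 0 := by positivity
        rw [← mul_pow]
        generalize hX : ((n:ℝ)+1)*((m:ℝ)+1) = X
        have hX0 : X ≠ 0 := hX ▸ mul_ne_zero h1 h2
        rw [← pow_mul X, mul_comm 2, pow_mul X, ]
        field_simp

/-- Expected bandwidth, sparse regime: if `e_k² / (n_k·m_k) → 0`, the average of `I(E)` over
all `e_k`-cell configurations tends to `0`. -/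
theorem expected_bandwidth_sparse (n m e : ℕ → ℕ)
    (hn : Tendsto n atTop atTop) (hm : Tendsto m atTop atTop) (he : Tendsto e atTop atTop)
    (hpos : ∀ k, 0 < n k ∧ 0 < m k ∧ 0 < e k)
    (hle : ∀ k, e k ≤ (n k + 1) * (m k + 1))
    (hsparse : Tendsto (fun k => ((e k : ℝ) ^ 2 / ((n k : ℝ) * (m k : ℝ)))) atTop (nhds 0)) :
    Tendsto
      (fun k =>
        (∑ E ∈ Finset.powersetCard (e k)
            (Finset.univ : Finset (Fin (n k + 1) × Fin (m k + 1))),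
            (minFRS (n k) (m k) E : ℝ)) /
          (Nat.choose ((n k + 1) * (m k + 1)) (e k) : ℝ))
      atTop (nhds 0) := by
  refine squeeze_zero' (Eventually.of_forall fun k => by positivity) ?_ hsparse
  have hsm : ∀ᶠ k in atTop, (e k : ℝ) ^ 2 / ((n k : ℝ) * (m k : ℝ)) < 1/2 :=
    hsparse.eventually (gt_mem_nhds (by norm_num))
  filter_upwards [hsm] with k hk
  refine (avg_bound (n k) (m k) (e k) (hle k)).trans ?_
  obtain ⟨h1, h2, -⟩ := hpos k
  have h1' : (0:ℝ) < n k := by exact_mod_cast h1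
  have h2' : (0:ℝ) < m k := by exact_mod_cast h2
  have hx : (e k:ℝ)^2 / (((n k:ℝ)+1)*((m k:ℝ)+1)) ≤ (e k : ℝ) ^ 2 / ((n k : ℝ) * (m k : ℝ)) := by
    gcongr <;> linarith
  refine le_trans ?_ hx
  have hx0 : 0 ≤ (e k:ℝ)^2 / (((n k:ℝ)+1)*((m k:ℝ)+1)) := by positivity
  generalize (e k:ℝ)^2 / (((n k:ℝ)+1)*((m k:ℝ)+1)) = x at *
  have hx2 : x < 1/2 := lt_of_le_of_lt hx hk
  simp only [pow_add]
  rw [← Finset.sum_mul]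
  have hg : ∑ t ∈ Finset.range (n k + 1), x ^ t ≤ 2 := by
    have := geom_sum_mul_neg x (n k + 1)
    have hp : 0 ≤ x ^ (n k + 1) := by positivity
    have hs : 0 ≤ ∑ t ∈ Finset.range (n k + 1), x ^ t := Finset.sum_nonneg fun _ _ => by positivity
    nlinarith
  nlinarith [mul_le_mul_of_nonneg_right hg (sq_nonneg x)]
end

section
/- (Expected bandwidth, critical regime) Let (n_k), (m_k), (e_k) be sequences of positive integers tending to infinity with e_k ≤ N_k := (n_k+1)(m_k+1), such that e_k = Θ(n_k), e_k = Θ(m_k) (i.e. there exist constants 0 < a ≤ b with a·n_k ≤ e_k ≤ b·n_k and a·m_k ≤ e_k ≤ b·m_k for all k), and e_k² / ((n_k+1)(m_k+1)) → x for some x ∈ (0,1). Then the average of I(E) over all binom(N_k, e_k) error configurations E with exactly e_k cells tends to −(ln(1−x) + x)/2 as k → ∞. -/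
open Filter Topology

set_option linter.unusedSectionVars false
set_option linter.unusedFintypeInType false
set_option linter.unusedDecidableInType false

section Circuits

variable {α β : Type*} [Fintype α] [Fintype β] [DecidableEq α] [DecidableEq β]

def StopSet (S : Finset (α × β)) : Prop :=
  ∀ c ∈ S, (∃ c' ∈ S, c'.1 = c.1 ∧ c' ≠ c) ∧ (∃ c' ∈ S, c'.2 = c.2 ∧ c' ≠ c)

def cyc {j : ℕ} (r : Fin (j+2) → α) (c : Fin (j+2) → β) : Finset (α × β) :=
  Finset.univ.image (fun i => (r i, c i)) ∪ Finset.univ.image (fun i => (r (i+1), c i))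

lemma mem_cyc {j : ℕ} (r : Fin (j+2) → α) (c : Fin (j+2) → β) (x : α × β) :
    x ∈ cyc r c ↔ ∃ i, x = (r i, c i) ∨ x = (r (i+1), c i) := by
  simp only [cyc, Finset.mem_union, Finset.mem_image, Finset.mem_univ, true_and]
  constructor
  · rintro (⟨i, h⟩ | ⟨i, h⟩)
    · exact ⟨i, Or.inl h.symm⟩
    · exact ⟨i, Or.inr h.symm⟩
  · rintro ⟨i, h | h⟩
    · exact Or.inl ⟨i, h.symm⟩
    · exact Or.inr ⟨i, h.symm⟩

lemma fin_ne_succ {j : ℕ} (i : Fin (j+2)) : i + 1 ≠ i := by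
  intro h
  have : (1 : Fin (j+2)) = 0 := by simpa using h
  exact absurd this (by simp)

lemma fin_cyc_ind {j : ℕ} (P : Fin (j+2) → Prop) (h0 : P 0) (hs : ∀ i, P i → P (i+1)) :
    ∀ i, P i := by
  intro i
  induction i using Fin.induction with
  | zero => exact h0
  | succ i ih =>
    have := hs _ ih
    rwa [Fin.coeSucc_eq_succ] at this

lemma fin_cyc_ind' {j : ℕ} (P : Fin (j+2) → Prop) (i₀ : Fin (j+2)) (h0 : P i₀)
    (hs : ∀ i, P i → P (i+1)) : ∀ i, P i := by
  intro i
  have := fin_cyc_ind (fun t => P (i₀ + t)) (by simpa using h0)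
    (fun t ht => by rw [← add_assoc]; exact hs _ ht) (i - i₀)
  simpa using this

lemma card_cyc {j : ℕ} {r : Fin (j+2) → α} {c : Fin (j+2) → β}
    (hr : r.Injective) (hc : c.Injective) : (cyc r c).card = 2 * (j+2) := by
  rw [cyc, Finset.card_union_of_disjoint, Finset.card_image_of_injective,
    Finset.card_image_of_injective]
  · simp; ring
  · intro a b h; exact hc (Prod.mk.inj h).2
  · intro a b h; exact hc (Prod.mk.inj h).2
  · rw [Finset.disjoint_left]
    intro x hx hy
    simp only [Finset.mem_image, Finset.mem_univ, true_and] at hx hy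
    obtain ⟨i, rfl⟩ := hx
    obtain ⟨i', h⟩ := hy
    obtain ⟨h1, h2⟩ := Prod.mk.inj h
    have := hc h2
    subst this
    exact fin_ne_succ _ (hr h1)

lemma cyc_nonempty {j : ℕ} (r : Fin (j+2) → α) (c : Fin (j+2) → β) : (cyc r c).Nonempty :=
  ⟨(r 0, c 0), (mem_cyc _ _ _).2 ⟨0, Or.inl rfl⟩⟩

lemma stop_cyc {j : ℕ} {r : Fin (j+2) → α} {c : Fin (j+2) → β}
    (hr : r.Injective) (hc : c.Injective) : StopSet (cyc r c) := by
  intro x hx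
  rw [mem_cyc] at hx
  obtain ⟨i, rfl | rfl⟩ := hx
  · refine ⟨⟨(r i, c (i-1)), (mem_cyc _ _ _).2 ⟨i-1, Or.inr (by simp)⟩, rfl, ?_⟩,
      ⟨(r (i+1), c i), (mem_cyc _ _ _).2 ⟨i, Or.inr rfl⟩, rfl, ?_⟩⟩
    · intro h
      have := hc (Prod.mk.inj h).2
      exact fin_ne_succ (i-1) (by simpa using this.symm)
    · intro h
      exact fin_ne_succ i (hr (Prod.mk.inj h).1)
  · refine ⟨⟨(r (i+1), c (i+1)), (mem_cyc _ _ _).2 ⟨i+1, Or.inl rfl⟩, rfl, ?_⟩,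
      ⟨(r i, c i), (mem_cyc _ _ _).2 ⟨i, Or.inl rfl⟩, rfl, ?_⟩⟩
    · intro h
      exact fin_ne_succ i (hc (Prod.mk.inj h).2)
    · intro h
      exact fin_ne_succ i (hr (Prod.mk.inj h).1).symm

lemma cyc_minimal {j : ℕ} {r : Fin (j+2) → α} {c : Fin (j+2) → β}
    (hr : r.Injective) (hc : c.Injective) {D : Finset (α × β)} (hD : D ⊆ cyc r c)
    (hne : D.Nonempty) (hs : StopSet D) : D = cyc r c := by
  have hA : ∀ i, (r i, c i) ∈ D → (r (i+1), c i) ∈ D := by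
    intro i hi
    obtain ⟨_, ⟨y, hy, h2, hne⟩⟩ := hs _ hi
    obtain ⟨t, rfl | rfl⟩ := (mem_cyc _ _ _).1 (hD hy)
    · have := hc h2
      subst this; exact absurd rfl hne
    · have := hc h2
      subst this; exact hy
  have hB : ∀ i, (r (i+1), c i) ∈ D → (r (i+1), c (i+1)) ∈ D := by
    intro i hi
    obtain ⟨⟨y, hy, h2, hne⟩, _⟩ := hs _ hi
    obtain ⟨t, rfl | rfl⟩ := (mem_cyc _ _ _).1 (hD hy)
    · have := hr h2
      subst this; exact hy
    · have := hr h2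
      have : t = i := by simpa using this
      subst this; exact absurd rfl hne
  obtain ⟨x, hx⟩ := hne
  have h0 : ∃ i, (r i, c i) ∈ D := by
    obtain ⟨t, rfl | rfl⟩ := (mem_cyc _ _ _).1 (hD hx)
    · exact ⟨_, hx⟩
    · exact ⟨_, hB _ hx⟩
  obtain ⟨i₀, h0⟩ := h0
  have hall := fin_cyc_ind' (fun i => (r i, c i) ∈ D) i₀ h0 (fun i hi => hB i (hA i hi))
  apply Finset.Subset.antisymm hD
  intro y hy
  obtain ⟨t, rfl | rfl⟩ := (mem_cyc _ _ _).1 hy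
  · exact hall t
  · exact hA t (hall t)

lemma cyc_inj {j : ℕ} {r r' : Fin (j+2) → α} {c c' : Fin (j+2) → β}
    (hr : r.Injective) (hc : c.Injective) (hr' : r'.Injective) (hc' : c'.Injective)
    (h : cyc r c = cyc r' c') (h1 : r 0 = r' 0) (h2 : c 0 = c' 0) : r = r' ∧ c = c' := by
  have key := fin_cyc_ind (fun i => r i = r' i ∧ c i = c' i) ⟨h1, h2⟩ (by
    rintro i ⟨hi1, hi2⟩
    have hA : r (i+1) = r' (i+1) := by
      have : (r (i+1), c i) ∈ cyc r' c' := h ▸ (mem_cyc _ _ _).2 ⟨i, Or.inr rfl⟩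
      obtain ⟨t, ht | ht⟩ := (mem_cyc _ _ _).1 this
      · obtain ⟨ha, hb⟩ := Prod.mk.inj ht
        have := hc' (hi2.symm.trans hb)
        subst this
        exact absurd (hr (ha.trans hi1.symm)) (fin_ne_succ _)
      · obtain ⟨ha, hb⟩ := Prod.mk.inj ht
        have := hc' (hi2.symm.trans hb)
        subst this
        exact ha
    refine ⟨hA, ?_⟩
    have : (r (i+1), c (i+1)) ∈ cyc r' c' := h ▸ (mem_cyc _ _ _).2 ⟨i+1, Or.inl rfl⟩
    obtain ⟨t, ht | ht⟩ := (mem_cyc _ _ _).1 this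
    · obtain ⟨ha, hb⟩ := Prod.mk.inj ht
      have := hr' (hA.symm.trans ha)
      subst this
      exact hb
    · obtain ⟨ha, hb⟩ := Prod.mk.inj ht
      have := hr' (hA.symm.trans ha)
      have : i = t := by simpa using this
      subst this
      exact absurd (hc (hb.trans hi2.symm)) (fin_ne_succ _))
  exact ⟨funext fun i => (key i).1, funext fun i => (key i).2⟩

lemma cyc_pointed {j : ℕ} {r : Fin (j+2) → α} {c : Fin (j+2) → β}
    (hr : r.Injective) (hc : c.Injective) {x : α × β} (hx : x ∈ cyc r c) :
    ∃ (r' : Fin (j+2) → α) (c' : Fin (j+2) → β), r'.Injective ∧ c'.Injective ∧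
      cyc r' c' = cyc r c ∧ (r' 0, c' 0) = x := by
  obtain ⟨i, rfl | rfl⟩ := (mem_cyc _ _ _).1 hx
  · refine ⟨fun t => r (i + t), fun t => c (i + t), fun a b h => by simpa using hr h,
      fun a b h => by simpa using hc h, ?_, by simp⟩
    ext y
    simp only [mem_cyc]
    constructor
    · rintro ⟨t, h | h⟩
      · exact ⟨i + t, Or.inl h⟩
      · exact ⟨i + t, Or.inr (by rw [h, add_assoc])⟩
    · rintro ⟨t, h | h⟩
      · exact ⟨t - i, Or.inl (by rw [h]; simp)⟩
      · exact ⟨t - i, Or.inr (by rw [h, ← add_assoc]; simp)⟩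
  · refine ⟨fun t => r (i + 1 - t), fun t => c (i - t), fun a b h => by simpa using hr h,
      fun a b h => by simpa using hc h, ?_, by simp⟩
    ext y
    simp only [mem_cyc]
    constructor
    · rintro ⟨t, h | h⟩
      · exact ⟨i - t, Or.inr (by rw [h]; congr 2; abel)⟩
      · exact ⟨i - t, Or.inl (by rw [h]; congr 2; abel)⟩
    · rintro ⟨t, h | h⟩
      · exact ⟨i - t, Or.inr (by rw [h]; congr 2 <;> abel)⟩
      · exact ⟨i - t, Or.inl (by rw [h]; congr 2 <;> abel)⟩

variable (α β) in
noncomputable def Circ (j : ℕ) : Finset (Finset (α × β)) :=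
  (Finset.univ : Finset ((Fin (j+2) ↪ α) × (Fin (j+2) ↪ β))).image (fun p => cyc p.1 p.2)

lemma mem_Circ {j : ℕ} {C : Finset (α × β)} : C ∈ Circ α β j ↔
    ∃ (r : Fin (j+2) → α) (c : Fin (j+2) → β), r.Injective ∧ c.Injective ∧ cyc r c = C := by
  simp only [Circ, Finset.mem_image, Finset.mem_univ, true_and]
  constructor
  · rintro ⟨p, h⟩
    exact ⟨p.1, p.2, p.1.injective, p.2.injective, h⟩
  · rintro ⟨r, c, hr, hc, h⟩
    exact ⟨(⟨r, hr⟩, ⟨c, hc⟩), h⟩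

lemma card_Circ (j : ℕ) : (Circ α β j).card * (2 * (j+2)) =
    (Fintype.card α).descFactorial (j+2) * (Fintype.card β).descFactorial (j+2) := by
  have h1 : (Finset.univ : Finset ((Fin (j+2) ↪ α) × (Fin (j+2) ↪ β))).card =
      (Fintype.card α).descFactorial (j+2) * (Fintype.card β).descFactorial (j+2) := by
    rw [Finset.card_univ, Fintype.card_prod, Fintype.card_embedding_eq,
      Fintype.card_embedding_eq, Fintype.card_fin]
  rw [← h1, Finset.card_eq_sum_card_image (fun p : (Fin (j+2) ↪ α) × (Fin (j+2) ↪ β) =>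
    cyc p.1 p.2), ← smul_eq_mul, ← Finset.sum_const]
  apply Finset.sum_congr rfl
  intro C hC
  obtain ⟨r, c, hr, hc, rfl⟩ := mem_Circ.1 hC
  rw [← card_cyc hr hc]
  symm
  apply Finset.card_bij (fun p _ => (p.1 0, p.2 0))
  · intro p hp
    simp only [Finset.mem_filter, Finset.mem_univ, true_and] at hp
    rw [← hp, mem_cyc]
    exact ⟨0, Or.inl rfl⟩
  · intro p hp q hq h
    simp only [Finset.mem_filter, Finset.mem_univ, true_and] at hp hq
    obtain ⟨ha, hb⟩ := Prod.mk.inj h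
    obtain ⟨h1, h2⟩ := cyc_inj p.1.injective p.2.injective q.1.injective q.2.injective
      (hp.trans hq.symm) ha hb
    exact Prod.ext (DFunLike.coe_injective h1) (DFunLike.coe_injective h2)
  · intro x hx
    obtain ⟨r', c', hr', hc', h, h'⟩ := cyc_pointed hr hc hx
    exact ⟨(⟨r', hr'⟩, ⟨c', hc'⟩), by simpa using h, h'⟩

lemma exists_walk {S : Finset (α × β)} (hs : StopSet S) (hne : S.Nonempty) :
    ∃ (r : ℕ → α) (c : ℕ → β), ∀ i, (r i, c i) ∈ S ∧ (r (i+1), c i) ∈ S ∧ r i ≠ r (i+1) ∧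
      c i ≠ c (i+1) := by
  obtain ⟨x0, hx0⟩ := hne
  have hg : ∀ x : S, ∃ y : S, y.1.1 = x.1.1 ∧ y ≠ x := by
    intro x
    obtain ⟨⟨y, hy, h, h'⟩, _⟩ := hs x.1 x.2
    exact ⟨⟨y, hy⟩, h, fun e => h' (congrArg Subtype.val e)⟩
  have hf : ∀ x : S, ∃ y : S, y.1.2 = x.1.2 ∧ y ≠ x := by
    intro x
    obtain ⟨_, ⟨y, hy, h, h'⟩⟩ := hs x.1 x.2
    exact ⟨⟨y, hy⟩, h, fun e => h' (congrArg Subtype.val e)⟩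
  choose g hg1 hg2 using hg
  choose f hf1 hf2 using hf
  let X : ℕ → S := fun i => (fun x => g (f x))^[i] ⟨x0, hx0⟩
  have hX : ∀ i, X (i+1) = g (f (X i)) := fun i => Function.iterate_succ_apply' _ _ _
  refine ⟨fun i => (X i).1.1, fun i => (X i).1.2, fun i => ?_⟩
  have e1 : (X (i+1)).1.1 = (f (X i)).1.1 := by rw [hX, hg1]
  have e2 : (X i).1.2 = (f (X i)).1.2 := by rw [hf1]
  refine ⟨(X i).2, ?_, ?_, ?_⟩
  · show ((X (i+1)).1.1, (X i).1.2) ∈ S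
    rw [e1, e2]; exact (f (X i)).2
  · show (X i).1.1 ≠ (X (i+1)).1.1
    rw [e1]
    intro h
    exact hf2 (X i) (Subtype.ext (Prod.ext h.symm e2.symm))
  · show (X i).1.2 ≠ (X (i+1)).1.2
    rw [e2]
    intro h
    apply hg2 (f (X i))
    rw [← hX]
    exact Subtype.ext (Prod.ext e1 h.symm)

lemma inj_of_gap {γ : Type*} {k i : ℕ} (r : ℕ → γ)
    (h : ∀ g, 0 < g → g < k → ∀ i, r i ≠ r (i+g)) :
    Function.Injective (fun t : Fin k => r (i + t)) := by
  have aux : ∀ s t : Fin k, s < t → r (i + s) ≠ r (i + t) := by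
    intro s t hst
    have hst' : (s : ℕ) < t := hst
    have := h (t - s) (by omega) (by omega) (i + s)
    rwa [show i + (s:ℕ) + ((t:ℕ) - s) = i + t by omega] at this
  intro s t hst
  rcases lt_trichotomy s t with h1 | h1 | h1
  · exact absurd hst (aux _ _ h1)
  · exact h1
  · exact absurd hst.symm (aux _ _ h1)

lemma exists_cyc_s14 {S : Finset (α × β)} (hs : StopSet S) (hne : S.Nonempty) :
    ∃ j, ∃ C ∈ Circ α β j, C ⊆ S := by
  obtain ⟨r, c, h⟩ := exists_walk hs hne
  have hex : ∃ k, 0 < k ∧ ((∃ i, r i = r (i+k)) ∨ (∃ i, c i = c (i+k))) := by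
    obtain ⟨a, b, hab, hne⟩ := Finite.exists_ne_map_eq_of_infinite r
    rcases lt_or_gt_of_ne hab with h1 | h1
    · exact ⟨b - a, by omega, Or.inl ⟨a, by rw [hne]; congr 1; omega⟩⟩
    · exact ⟨a - b, by omega, Or.inl ⟨b, by rw [← hne]; congr 1; omega⟩⟩
  classical
  obtain ⟨hk0, hk⟩ := Nat.find_spec hex
  have hmin := fun g (hg : g < Nat.find hex) => Nat.find_min hex hg
  generalize Nat.find hex = k at *
  have hrg : ∀ g, 0 < g → g < k → ∀ i, r i ≠ r (i+g) := fun g h0 hg i hh =>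
    hmin g hg ⟨h0, Or.inl ⟨i, hh⟩⟩
  have hcg : ∀ g, 0 < g → g < k → ∀ i, c i ≠ c (i+g) := fun g h0 hg i hh =>
    hmin g hg ⟨h0, Or.inr ⟨i, hh⟩⟩
  have hk2 : k ≠ 1 := by
    rintro rfl
    rcases hk with ⟨i, hi⟩ | ⟨i, hi⟩
    · exact (h i).2.2.1 hi
    · exact (h i).2.2.2 hi
  obtain ⟨j, rfl⟩ : ∃ j, k = j + 2 := ⟨k - 2, by omega⟩
  have hval : ∀ t : Fin (j+2), (t = Fin.last (j+1) ∧ t + 1 = 0) ∨ ((t + 1 : Fin (j+2)) : ℕ) = t + 1 := by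
    intro t
    by_cases ht : t = Fin.last (j+1)
    · left; refine ⟨ht, ?_⟩
      rw [ht]; exact Fin.last_add_one _
    · right
      rw [Fin.val_add_one]; simp [ht]
  refine ⟨j, ?_⟩
  rcases hk with ⟨i, hi⟩ | ⟨i, hi⟩
  · refine ⟨_, mem_Circ.2 ⟨fun t => r (i + t), fun t => c (i + t), inj_of_gap r hrg,
      inj_of_gap c hcg, rfl⟩, ?_⟩
    intro x hx
    obtain ⟨t, rfl | rfl⟩ := (mem_cyc _ _ _).1 hx
    · exact (h _).1
    · rcases hval t with ⟨h1, h2⟩ | h2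
      · simp only [h2, h1]
        have := (h (i + (j+1))).2.1
        rw [show i + (j+1) + 1 = i + (j+2) by ring, ← hi] at this
        simpa using this
      · simp only [h2]
        exact (h _).2.1
  · refine ⟨_, mem_Circ.2 ⟨fun t => r (i + 1 + t), fun t => c (i + 1 + t), inj_of_gap r hrg,
      inj_of_gap c hcg, rfl⟩, ?_⟩
    intro x hx
    obtain ⟨t, rfl | rfl⟩ := (mem_cyc _ _ _).1 hx
    · exact (h _).1
    · rcases hval t with ⟨h1, h2⟩ | h2
      · simp only [h2, h1]
        have := (h i).2.1
        rw [hi] at this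
        simpa [show i + 1 + (j+1) = i + (j+2) by ring] using this
      · simp only [h2]
        exact (h _).2.1

lemma stop_union {C D : Finset (α × β)} (hC : StopSet C) (hD : StopSet D) :
    StopSet (C ∪ D) := by
  intro x hx
  rcases Finset.mem_union.1 hx with hx | hx
  · obtain ⟨⟨y, hy, h⟩, ⟨z, hz, h'⟩⟩ := hC x hx
    exact ⟨⟨y, Finset.mem_union_left _ hy, h⟩, ⟨z, Finset.mem_union_left _ hz, h'⟩⟩
  · obtain ⟨⟨y, hy, h⟩, ⟨z, hz, h'⟩⟩ := hD x hx
    exact ⟨⟨y, Finset.mem_union_right _ hy, h⟩, ⟨z, Finset.mem_union_right _ hz, h'⟩⟩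

lemma fiber_two {X Y : Type*} [DecidableEq X] [DecidableEq Y] (F : Finset X) (f : X → Y)
    (h : ∀ x ∈ F, ∃ y ∈ F, f y = f x ∧ y ≠ x) :
    2 * (F.image f).card ≤ F.card ∧ (F.card ≤ 2 * (F.image f).card →
      ∀ x ∈ F, ∀ y ∈ F, ∀ z ∈ F, f y = f x → y ≠ x → f z = f x → z ≠ x → y = z) := by
  have h2 : ∀ b ∈ F.image f, 2 ≤ (F.filter (fun a => f a = b)).card := by
    intro b hb
    obtain ⟨x, hx, rfl⟩ := Finset.mem_image.1 hb
    obtain ⟨y, hy, e, hne⟩ := h x hx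
    exact Finset.one_lt_card.2 ⟨y, by simp [hy, e], x, by simp [hx], hne⟩
  have hsum := Finset.card_eq_sum_card_image f F
  have hle : 2 * (F.image f).card ≤ F.card := by
    rw [hsum, mul_comm, ← smul_eq_mul, ← Finset.sum_const]
    exact Finset.sum_le_sum h2
  refine ⟨hle, fun hge x hx y hy z hz h1 h1' h2' h3 => ?_⟩
  by_contra hyz
  have h3' : 2 < (F.filter (fun a => f a = f x)).card :=
    Finset.two_lt_card.2 ⟨x, by simp [hx], y, by simp [hy, h1], z, by simp [hz, h2'],
      h1'.symm, h3.symm, hyz⟩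
  have : (F.image f).card * 2 < F.card := by
    rw [hsum, ← smul_eq_mul, ← Finset.sum_const]
    exact Finset.sum_lt_sum h2 ⟨f x, Finset.mem_image_of_mem _ hx, h3'⟩
  omega

def DenseCfg (F : Finset (α × β)) : Prop := (F.image Prod.fst).card + (F.image Prod.snd).card < F.card

lemma dense_union {j j' : ℕ} {C D : Finset (α × β)} (hC : C ∈ Circ α β j) (hD : D ∈ Circ α β j')
    (hne : C ≠ D) (hi : ¬ Disjoint C D) : DenseCfg (C ∪ D) := by
  obtain ⟨r, c, hr, hc, rfl⟩ := mem_Circ.1 hC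
  obtain ⟨r', c', hr', hc', rfl⟩ := mem_Circ.1 hD
  have hs := stop_cyc hr hc
  have hs' := stop_cyc hr' hc'
  have hsu := stop_union hs hs'
  rw [Finset.not_disjoint_iff] at hi
  obtain ⟨x, hx, hx'⟩ := hi
  by_contra hd
  unfold DenseCfg at hd
  obtain ⟨ha, ha'⟩ := fiber_two (cyc r c ∪ cyc r' c') Prod.fst (fun x hx => (hsu x hx).1)
  obtain ⟨hb, hb'⟩ := fiber_two (cyc r c ∪ cyc r' c') Prod.snd (fun x hx => (hsu x hx).2)
  have ha'' := ha' (by omega)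
  have hb'' := hb' (by omega)
  have hst : StopSet (cyc r c ∩ cyc r' c') := by
    intro x hx
    obtain ⟨h1, h2⟩ := Finset.mem_inter.1 hx
    obtain ⟨⟨y, hy, e, n⟩, ⟨z, hz, e', n'⟩⟩ := hs x h1
    obtain ⟨⟨y1, hy1, e1, n1⟩, ⟨z1, hz1, e1', n1'⟩⟩ := hs' x h2
    have e3 := ha'' x (Finset.mem_union_left _ h1) y (Finset.mem_union_left _ hy) y1
      (Finset.mem_union_right _ hy1) e n e1 n1
    have e4 := hb'' x (Finset.mem_union_left _ h1) z (Finset.mem_union_left _ hz) z1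
      (Finset.mem_union_right _ hz1) e' n' e1' n1'
    subst e3 e4
    exact ⟨⟨y, Finset.mem_inter.2 ⟨hy, hy1⟩, e, n⟩, ⟨z, Finset.mem_inter.2 ⟨hz, hz1⟩, e', n'⟩⟩
  have hne' : (cyc r c ∩ cyc r' c').Nonempty := ⟨x, Finset.mem_inter.2 ⟨hx, hx'⟩⟩
  exact hne ((cyc_minimal hr hc Finset.inter_subset_left hne' hst).symm.trans
    (cyc_minimal hr' hc' Finset.inter_subset_right hne' hst))

end Circuits

section Bounds

variable {n m : ℕ}

lemma good_iff_stopping (E : Finset (Fin (n+1) × Fin (m+1))) :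
    IsGood n m E ↔ ∀ S ⊆ E, S.Nonempty → ¬ StopSet S := by
  unfold IsGood StopSet
  refine forall_congr' fun S => forall_congr' fun hS => forall_congr' fun hne => ?_
  push Not
  refine exists_congr fun c => and_congr_right fun hc => ?_
  constructor
  · rintro (h | h)
    · rintro ⟨y, hy, e, hne⟩
      exact absurd (h y hy e) hne
    · rintro _ y hy e
      exact h y hy e
  · intro h
    by_cases h1 : ∃ c' ∈ S, c'.1 = c.1 ∧ c' ≠ c
    · exact Or.inr (h h1)
    · push Not at h1
      exact Or.inl h1

lemma minFRS_le_card (E E' : Finset (Fin (n+1) × Fin (m+1))) (h : E' ⊆ E)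
    (hg : IsGood n m (E \ E')) : minFRS n m E ≤ E'.card :=
  Nat.sInf_le ⟨E', h, hg, rfl⟩

lemma minFRS_spec (E : Finset (Fin (n+1) × Fin (m+1))) :
    ∃ E' ⊆ E, IsGood n m (E \ E') ∧ E'.card = minFRS n m E := by
  have : {k | ∃ E' ⊆ E, IsGood n m (E \ E') ∧ E'.card = k}.Nonempty := by
    refine ⟨_, E, subset_rfl, ?_, rfl⟩
    intro S hS hne
    rw [Finset.sdiff_self] at hS
    exact absurd (Finset.subset_empty.1 hS) hne.ne_empty
  exact Nat.sInf_mem this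

lemma minFRS_upper (E : Finset (Fin (n+1) × Fin (m+1))) :
    minFRS n m E ≤ ∑ j ∈ Finset.range (n+1),
      ((Circ (Fin (n+1)) (Fin (m+1)) j).filter (fun C => C ⊆ E)).card := by
  classical
  set 𝒞 := (Finset.range (n+1)).biUnion
    (fun j => (Circ (Fin (n+1)) (Fin (m+1)) j).filter (fun C => C ⊆ E)) with h𝒞
  have hcard : 𝒞.card ≤ _ := Finset.card_biUnion_le
  refine le_trans ?_ hcard
  have hmem : ∀ C, C ∈ 𝒞 ↔ ∃ j, j < n+1 ∧ C ∈ Circ (Fin (n+1)) (Fin (m+1)) j ∧ C ⊆ E := by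
    intro C; simp [h𝒞]
  have hne : ∀ C ∈ 𝒞, ∃ x, x ∈ C := by
    intro C hC
    obtain ⟨j, _, h, _⟩ := (hmem C).1 hC
    obtain ⟨r, c, _, _, rfl⟩ := mem_Circ.1 h
    exact cyc_nonempty r c
  choose pick hpick using hne
  let E' := 𝒞.attach.image (fun C => pick C.1 C.2)
  have hle : E'.card ≤ 𝒞.card := by
    refine Finset.card_image_le.trans ?_
    rw [Finset.card_attach]
  refine le_trans (minFRS_le_card E E' ?_ ?_) hle
  · intro x hx
    obtain ⟨C, _, rfl⟩ := Finset.mem_image.1 hx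
    obtain ⟨j, _, _, h⟩ := (hmem C.1).1 C.2
    exact h (hpick C.1 C.2)
  · rw [good_iff_stopping]
    intro S hS hne hstS
    obtain ⟨j, C, hC, hCS⟩ := exists_cyc_s14 hstS hne
    have hj : j < n+1 := by
      obtain ⟨r, c, hr, _, _⟩ := mem_Circ.1 hC
      have := Fintype.card_le_of_injective r hr
      simp at this
      omega
    have hC' : C ∈ 𝒞 := (hmem C).2 ⟨j, hj, hC, fun x hx => (Finset.mem_sdiff.1 (hS (hCS hx))).1⟩
    have h1 := hCS (hpick C hC')
    exact (Finset.mem_sdiff.1 (hS h1)).2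
      (Finset.mem_image.2 ⟨⟨C, hC'⟩, Finset.mem_attach _ _, rfl⟩)

open Classical in
noncomputable def denseFam (n m L : ℕ) : Finset (Finset (Fin (n+1) × Fin (m+1))) :=
  Finset.univ.filter (fun F => DenseCfg F ∧ F.card ≤ L)

lemma minFRS_lower (K : ℕ) (E : Finset (Fin (n+1) × Fin (m+1))) :
    ∑ j ∈ Finset.range K,
      ((Circ (Fin (n+1)) (Fin (m+1)) j).filter (fun C => C ⊆ E)).card ≤
    minFRS n m E + 2 ^ (4*K+4) * ((denseFam n m (4*K+4)).filter (fun F => F ⊆ E)).card := by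
  classical
  have hcardC : ∀ j, ∀ C ∈ Circ (Fin (n+1)) (Fin (m+1)) j, C.card = 2 * (j+2) := by
    intro j C hC
    obtain ⟨r, c, hr, hc, rfl⟩ := mem_Circ.1 hC
    exact card_cyc hr hc
  set 𝒞 := (Finset.range K).biUnion
    (fun j => (Circ (Fin (n+1)) (Fin (m+1)) j).filter (fun C => C ⊆ E)) with h𝒞
  have hmem : ∀ C, C ∈ 𝒞 ↔ ∃ j, j < K ∧ C ∈ Circ (Fin (n+1)) (Fin (m+1)) j ∧ C ⊆ E := by
    intro C; simp [h𝒞]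
  rw [← Finset.card_biUnion (by
    intro j _ j' _ hjj
    rw [Function.onFun, Finset.disjoint_left]
    intro C h1 h2
    have := hcardC j C (Finset.mem_filter.1 h1).1
    have := hcardC j' C (Finset.mem_filter.1 h2).1
    omega), ← h𝒞]
  obtain ⟨E', hE', hgood, hE'card⟩ := minFRS_spec E
  rw [← hE'card]
  rw [← Finset.card_filter_add_card_filter_not (s := 𝒞)
    (fun C => ∀ D ∈ 𝒞, C ≠ D → Disjoint C D)]
  apply Nat.add_le_add
  · have hhit : ∀ C ∈ 𝒞, ∃ x, x ∈ C ∧ x ∈ E' := by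
      intro C hC
      by_contra hno
      push Not at hno
      obtain ⟨j, _, h, hCE⟩ := (hmem C).1 hC
      obtain ⟨r, c, hr, hc, rfl⟩ := mem_Circ.1 h
      exact (good_iff_stopping _).1 hgood _ (fun x hx => Finset.mem_sdiff.2 ⟨hCE hx, hno x hx⟩)
        (cyc_nonempty r c) (stop_cyc hr hc)
    choose! pick hp1 hp2 using hhit
    apply Finset.card_le_card_of_injOn pick
    · intro C hC
      exact hp2 C (Finset.mem_filter.1 hC).1
    · intro C hC D hD h
      by_contra hne
      have hC' := (Finset.mem_filter.1 hC)
      have hD' := (Finset.mem_filter.1 hD)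
      have := hC'.2 D hD'.1 hne
      exact Finset.disjoint_left.1 this (hp1 C hC'.1) (h ▸ hp1 D hD'.1)
  · calc _ ≤ (((denseFam n m (4*K+4)).filter (fun F => F ⊆ E)).biUnion
          (fun F => F.powerset)).card := by
          apply Finset.card_le_card
          intro C hC
          obtain ⟨hC1, hC2⟩ := Finset.mem_filter.1 hC
          push Not at hC2
          obtain ⟨D, hD, hne, hdis⟩ := hC2
          obtain ⟨j, hj, h, hCE⟩ := (hmem C).1 hC1
          obtain ⟨j', hj', h', hDE⟩ := (hmem D).1 hD
          rw [Finset.mem_biUnion]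
          refine ⟨C ∪ D, Finset.mem_filter.2 ⟨?_, Finset.union_subset hCE hDE⟩,
            Finset.mem_powerset.2 Finset.subset_union_left⟩
          rw [denseFam, Finset.mem_filter]
          refine ⟨Finset.mem_univ _, dense_union h h' hne hdis, ?_⟩
          have := Finset.card_union_le C D
          rw [hcardC _ _ h, hcardC _ _ h'] at this
          omega
      _ ≤ ∑ F ∈ (denseFam n m (4*K+4)).filter (fun F => F ⊆ E), F.powerset.card :=
          Finset.card_biUnion_le
      _ ≤ ∑ F ∈ (denseFam n m (4*K+4)).filter (fun F => F ⊆ E), 2 ^ (4*K+4) := by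
          apply Finset.sum_le_sum
          intro F hF
          rw [Finset.card_powerset]
          apply Nat.pow_le_pow_right (by norm_num)
          have := (Finset.mem_filter.1 hF).1
          rw [denseFam, Finset.mem_filter] at this
          exact this.2.2
      _ = _ := by rw [Finset.sum_const, smul_eq_mul, mul_comm]

noncomputable def pr (N e f : ℕ) : ℝ := (e.descFactorial f : ℝ) / (N.descFactorial f : ℝ)

lemma pr_nonneg (N e f : ℕ) : 0 ≤ pr N e f := by unfold pr; positivity

lemma pr_le (N e f : ℕ) (h : e ≤ N) : pr N e f ≤ ((e : ℝ) / N) ^ f := by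
  induction f with
  | zero => simp [pr]
  | succ f ih =>
    have : pr N e (f+1) = (((e - f : ℕ) : ℝ) / ((N - f : ℕ) : ℝ)) * pr N e f := by
      unfold pr
      rw [Nat.descFactorial_succ, Nat.descFactorial_succ]
      push_cast
      rw [mul_div_mul_comm]
    rw [this, pow_succ, mul_comm]
    apply mul_le_mul ih _ (by positivity) (by positivity)
    rcases le_or_gt e f with hf | hf
    · rw [Nat.sub_eq_zero_of_le hf]; simp; positivity
    · have hN : f < N := lt_of_lt_of_le hf h
      rw [Nat.cast_sub hf.le, Nat.cast_sub hN.le]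
      have h1 : (f:ℝ) < N := by exact_mod_cast hN
      have h2 : (e:ℝ) ≤ N := by exact_mod_cast h
      have h3 : (0:ℝ) ≤ f := by positivity
      rw [div_le_div_iff₀ (by linarith) (by linarith)]
      nlinarith

lemma card_superset {X : Type*} [Fintype X] [DecidableEq X] (F : Finset X) (e : ℕ)
    (he : e ≤ Fintype.card X) :
    (((Finset.powersetCard e (Finset.univ : Finset X)).filter (fun E => F ⊆ E)).card : ℝ) =
      pr (Fintype.card X) e F.card * ((Fintype.card X).choose e : ℝ) := by
  rcases lt_or_ge e F.card with hf | hf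
  · have : (Finset.powersetCard e (Finset.univ : Finset X)).filter (fun E => F ⊆ E) = ∅ := by
      rw [Finset.filter_eq_empty_iff]
      intro E hE hFE
      have := Finset.card_le_card hFE
      rw [(Finset.mem_powersetCard.1 hE).2] at this
      omega
    rw [this, pr, Nat.descFactorial_of_lt hf]
    simp
  · have h1 : ((Finset.powersetCard e (Finset.univ : Finset X)).filter (fun E => F ⊆ E)).card =
        (Finset.powersetCard (e - F.card) (Finset.univ \ F)).card := by
      apply Finset.card_bij' (fun E _ => E \ F) (fun G _ => G ∪ F)
      · intro E hE
        simp only [Finset.mem_filter, Finset.mem_powersetCard] at hE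
        rw [Finset.mem_powersetCard]
        refine ⟨Finset.sdiff_subset_sdiff hE.1.1 subset_rfl, ?_⟩
        rw [Finset.card_sdiff_of_subset hE.2, hE.1.2]
      · intro G hG
        rw [Finset.mem_powersetCard] at hG
        have hd : Disjoint G F := Finset.disjoint_of_subset_left hG.1 Finset.sdiff_disjoint
        simp only [Finset.mem_filter, Finset.mem_powersetCard]
        refine ⟨⟨Finset.subset_univ _, ?_⟩, Finset.subset_union_right⟩
        rw [Finset.card_union_of_disjoint hd, hG.2]
        omega
      · intro E hE
        simp only [Finset.mem_filter] at hE
        exact Finset.sdiff_union_of_subset hE.2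
      · intro G hG
        rw [Finset.mem_powersetCard] at hG
        have hd : Disjoint G F := Finset.disjoint_of_subset_left hG.1 Finset.sdiff_disjoint
        rw [Finset.union_sdiff_right, Finset.sdiff_eq_self_of_disjoint hd]
    rw [h1, Finset.card_powersetCard, Finset.card_sdiff_of_subset (Finset.subset_univ _),
      Finset.card_univ, pr]
    have hfN : F.card ≤ Fintype.card X := hf.trans he
    have h2 := Nat.choose_mul (n := Fintype.card X) hf
    have hpos : (0:ℝ) < ((Fintype.card X).descFactorial F.card : ℝ) := by
      exact_mod_cast Nat.descFactorial_pos.2 hfN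
    rw [div_mul_eq_mul_div, eq_div_iff hpos.ne']
    rw [Nat.descFactorial_eq_factorial_mul_choose, Nat.descFactorial_eq_factorial_mul_choose]
    have h2' : ((Fintype.card X).choose e : ℝ) * (e.choose F.card) =
      (Fintype.card X).choose F.card * ((Fintype.card X - F.card).choose (e - F.card)) := by
      exact_mod_cast h2
    push_cast
    linear_combination (-(F.card.factorial : ℝ)) * h2'

lemma sum_count {X : Type*} [Fintype X] [DecidableEq X] (𝒮 : Finset (Finset X)) (e : ℕ)
    (he : e ≤ Fintype.card X) :
    ∑ E ∈ Finset.powersetCard e (Finset.univ : Finset X), ((𝒮.filter (fun C => C ⊆ E)).card : ℝ)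
      = (∑ C ∈ 𝒮, pr (Fintype.card X) e C.card) * ((Fintype.card X).choose e : ℝ) := by
  rw [Finset.sum_mul]
  simp_rw [← card_superset _ e he, Finset.card_filter, Nat.cast_sum]
  rw [Finset.sum_comm]

noncomputable def avgI (n m e : ℕ) : ℝ :=
  (∑ E ∈ Finset.powersetCard e (Finset.univ : Finset (Fin (n + 1) × Fin (m + 1))),
            (minFRS n m E : ℝ)) / (Nat.choose ((n + 1) * (m + 1)) e : ℝ)

noncomputable def T (n m e j : ℕ) : ℝ :=
  ((n+1).descFactorial (j+2) : ℝ) * ((m+1).descFactorial (j+2) : ℝ) / (2 * (j+2)) *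
    pr ((n+1)*(m+1)) e (2*(j+2))

lemma sum_Circ (n m e j : ℕ) :
    ∑ C ∈ Circ (Fin (n+1)) (Fin (m+1)) j, pr ((n+1)*(m+1)) e C.card = T n m e j := by
  have hcardC : ∀ C ∈ Circ (Fin (n+1)) (Fin (m+1)) j,
      pr ((n+1)*(m+1)) e C.card = pr ((n+1)*(m+1)) e (2 * (j+2)) := by
    intro C hC
    obtain ⟨r, c, hr, hc, rfl⟩ := mem_Circ.1 hC
    rw [card_cyc hr hc]
  rw [Finset.sum_congr rfl hcardC, Finset.sum_const, nsmul_eq_mul, T]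
  congr 1
  rw [eq_div_iff (by positivity)]
  have := card_Circ (α := Fin (n+1)) (β := Fin (m+1)) j
  simp only [Fintype.card_fin] at this
  exact_mod_cast this

lemma avg_upper (n m e : ℕ) (he : e ≤ (n+1)*(m+1)) :
    avgI n m e ≤ ∑ j ∈ Finset.range (n+1), T n m e j := by
  have hpos : (0:ℝ) < (Nat.choose ((n + 1) * (m + 1)) e : ℝ) := by
    exact_mod_cast Nat.choose_pos he
  rw [avgI, div_le_iff₀ hpos]
  calc _ ≤ ∑ E ∈ Finset.powersetCard e (Finset.univ : Finset (Fin (n + 1) × Fin (m + 1))),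
        ∑ j ∈ Finset.range (n+1),
      (((Circ (Fin (n+1)) (Fin (m+1)) j).filter (fun C => C ⊆ E)).card : ℝ) := by
        apply Finset.sum_le_sum
        intro E _
        exact_mod_cast minFRS_upper E
    _ = _ := by
        rw [Finset.sum_comm, Finset.sum_mul]
        apply Finset.sum_congr rfl
        intro j _
        have := sum_count (Circ (Fin (n+1)) (Fin (m+1)) j) e (by simpa using he)
        simp only [Fintype.card_prod, Fintype.card_fin] at this
        rw [this, sum_Circ]

noncomputable def denseErr (n m e K : ℕ) : ℝ :=
  ∑ F ∈ denseFam n m (4*K+4), pr ((n+1)*(m+1)) e F.card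

lemma avg_lower (n m e K : ℕ) (he : e ≤ (n+1)*(m+1)) :
    ∑ j ∈ Finset.range K, T n m e j - 2 ^ (4*K+4) * denseErr n m e K ≤ avgI n m e := by
  have hpos : (0:ℝ) < (Nat.choose ((n + 1) * (m + 1)) e : ℝ) := by
    exact_mod_cast Nat.choose_pos he
  rw [avgI, le_div_iff₀ hpos, sub_mul, sub_le_iff_le_add]
  calc _ = ∑ E ∈ Finset.powersetCard e (Finset.univ : Finset (Fin (n + 1) × Fin (m + 1))),
        ∑ j ∈ Finset.range K,
      (((Circ (Fin (n+1)) (Fin (m+1)) j).filter (fun C => C ⊆ E)).card : ℝ) := by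
        rw [Finset.sum_comm, Finset.sum_mul]
        apply Finset.sum_congr rfl
        intro j _
        have := sum_count (Circ (Fin (n+1)) (Fin (m+1)) j) e (by simpa using he)
        simp only [Fintype.card_prod, Fintype.card_fin] at this
        rw [this, sum_Circ]
    _ ≤ ∑ E ∈ Finset.powersetCard e (Finset.univ : Finset (Fin (n + 1) × Fin (m + 1))),
        ((minFRS n m E : ℝ) + 2 ^ (4*K+4) *
          (((denseFam n m (4*K+4)).filter (fun F => F ⊆ E)).card : ℝ)) := by
        apply Finset.sum_le_sum
        intro E _
        exact_mod_cast minFRS_lower K E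
    _ = _ := by
        rw [Finset.sum_add_distrib, ← Finset.mul_sum]
        have := sum_count (denseFam n m (4*K+4)) e (by simpa using he)
        simp only [Fintype.card_prod, Fintype.card_fin] at this
        rw [this, denseErr, mul_assoc]

lemma denseErr_le (n m e K : ℕ) (he : e ≤ (n+1)*(m+1)) (b : ℝ) (hb : 1 ≤ b)
    (h1 : (e : ℝ) ≤ b * (n+1)) (h2 : (e : ℝ) ≤ b * (m+1)) :
    denseErr n m e K ≤ (4*K+5)^2 * 2 ^ ((4*K+4)^2) * b ^ (2*(4*K+4)) *
      ((e : ℝ) / ((n+1)*(m+1))) := by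
  classical
  set L := 4*K+4 with hL
  set p : ℝ := (e : ℝ) / ((n+1)*(m+1)) with hp
  have hp0 : 0 ≤ p := by positivity
  have hp1 : p ≤ 1 := by
    rw [hp, div_le_one (by positivity)]
    exact_mod_cast he
  have hnp : ((n:ℝ)+1) * p ≤ b := by
    rw [hp]
    have : ((n:ℝ)+1) * ((e : ℝ) / ((n+1)*(m+1))) = e / (m+1) := by field_simp
    rw [this, div_le_iff₀ (by positivity)]
    exact h2
  have hmp : ((m:ℝ)+1) * p ≤ b := by
    rw [hp]
    have : ((m:ℝ)+1) * ((e : ℝ) / ((n+1)*(m+1))) = e / (n+1) := by field_simp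
    rw [this, div_le_iff₀ (by positivity)]
    exact h1
  let idx := Finset.range (L+1) ×ˢ Finset.range (L+1)
  let q : Finset (Fin (n+1) × Fin (m+1)) → ℕ × ℕ :=
    fun F => ((F.image Prod.fst).card, (F.image Prod.snd).card)
  have hmaps : ∀ F ∈ denseFam n m L, q F ∈ idx := by
    intro F hF
    rw [denseFam, Finset.mem_filter] at hF
    have ha : (F.image Prod.fst).card ≤ F.card := Finset.card_image_le
    have hb : (F.image Prod.snd).card ≤ F.card := Finset.card_image_le
    simp only [idx, q, Finset.mem_product, Finset.mem_range]
    omega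
  have hcnt : ∀ rc ∈ idx, (((denseFam n m L).filter (fun F => q F = rc)).card : ℝ) ≤
      (n+1 : ℝ)^rc.1 * (m+1)^rc.2 * 2 ^ (L^2) := by
    rintro ⟨r, c⟩ hrc
    simp only [idx, Finset.mem_product, Finset.mem_range] at hrc
    have hN : ((denseFam n m L).filter (fun F => q F = (r,c))).card ≤
        (n+1)^r * (m+1)^c * 2 ^ (L^2) := by
      calc _ ≤ ((Finset.powersetCard r (Finset.univ : Finset (Fin (n+1))) ×ˢ
            Finset.powersetCard c (Finset.univ : Finset (Fin (m+1)))).biUnion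
              (fun AB => (AB.1 ×ˢ AB.2).powerset)).card := by
            apply Finset.card_le_card
            intro F hF
            have hq := (Finset.mem_filter.1 hF).2
            obtain ⟨hq1, hq2⟩ := Prod.mk.inj hq
            rw [Finset.mem_biUnion]
            refine ⟨(F.image Prod.fst, F.image Prod.snd), ?_, ?_⟩
            · simp [Finset.mem_powersetCard, hq1, hq2]
            · rw [Finset.mem_powerset]
              exact Finset.subset_product
        _ ≤ ∑ AB ∈ (Finset.powersetCard r (Finset.univ : Finset (Fin (n+1))) ×ˢ
            Finset.powersetCard c (Finset.univ : Finset (Fin (m+1)))), 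
              (AB.1 ×ˢ AB.2).powerset.card := Finset.card_biUnion_le
        _ ≤ ∑ AB ∈ (Finset.powersetCard r (Finset.univ : Finset (Fin (n+1))) ×ˢ
            Finset.powersetCard c (Finset.univ : Finset (Fin (m+1)))), 2 ^ (L^2) := by
            apply Finset.sum_le_sum
            rintro ⟨A, B⟩ hAB
            rw [Finset.mem_product, Finset.mem_powersetCard, Finset.mem_powersetCard] at hAB
            rw [Finset.card_powerset, Finset.card_product]
            apply Nat.pow_le_pow_right (by norm_num)
            simp only [hAB.1.2, hAB.2.2]
            rw [sq]
            exact Nat.mul_le_mul (by omega) (by omega)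
        _ ≤ _ := by
            rw [Finset.sum_const, smul_eq_mul, Finset.card_product, Finset.card_powersetCard,
              Finset.card_powersetCard, Finset.card_univ, Finset.card_univ, Fintype.card_fin,
              Fintype.card_fin]
            gcongr
            · exact Nat.choose_le_pow _ _
            · exact Nat.choose_le_pow _ _
    exact_mod_cast hN
  unfold denseErr
  rw [← Finset.sum_fiberwise_of_maps_to hmaps]
  calc _ ≤ ∑ rc ∈ idx, 2 ^ (L^2) * b ^ (2*L) * p := by
        apply Finset.sum_le_sum
        intro rc hrc
        calc _ ≤ ∑ F ∈ (denseFam n m L).filter (fun F => q F = rc), p ^ (rc.1 + rc.2 + 1) := by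
              apply Finset.sum_le_sum
              intro F hF
              obtain ⟨hF1, hF2⟩ := Finset.mem_filter.1 hF
              rw [denseFam, Finset.mem_filter] at hF1
              have hd := hF1.2.1
              unfold DenseCfg at hd
              refine (pr_le _ _ _ he).trans ?_
              have : ((e:ℝ) / (((n+1)*(m+1) : ℕ) : ℝ)) = p := by rw [hp]; push_cast; rfl
              rw [this]
              apply pow_le_pow_of_le_one hp0 hp1
              rw [← hF2]
              exact hd
          _ ≤ ((n+1 : ℝ)^rc.1 * (m+1)^rc.2 * 2 ^ (L^2)) * p ^ (rc.1 + rc.2 + 1) := by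
              rw [Finset.sum_const, nsmul_eq_mul]
              exact mul_le_mul_of_nonneg_right (hcnt rc hrc) (by positivity)
          _ = 2 ^ (L^2) * ((((n:ℝ)+1)*p)^rc.1 * (((m:ℝ)+1)*p)^rc.2) * p := by
              rw [mul_pow, mul_pow]; ring
          _ ≤ _ := by
              have hrc' := hrc
              simp only [idx, Finset.mem_product, Finset.mem_range] at hrc'
              gcongr
              calc _ ≤ b ^ rc.1 * b ^ rc.2 := by gcongr
                _ = b ^ (rc.1 + rc.2) := (pow_add _ _ _).symm
                _ ≤ _ := pow_le_pow_right₀ hb (by omega)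
    _ = _ := by
        rw [Finset.sum_const, nsmul_eq_mul, Finset.card_product, Finset.card_range, hL]
        push_cast
        ring

end Bounds

section Asymp

lemma tendsto_descFact (k : ℕ) :
    Tendsto (fun n : ℕ => (n.descFactorial k : ℝ) / (n : ℝ) ^ k) atTop (𝓝 1) := by
  induction k with
  | zero => simp
  | succ k ih =>
    have h1 : Tendsto (fun n : ℕ => 1 - (k : ℝ) / (n : ℝ)) atTop (𝓝 (1 - 0)) :=
      tendsto_const_nhds.sub (tendsto_const_div_atTop_nhds_zero_nat (k : ℝ))
    have h2 := h1.mul ih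
    simp only [sub_zero, mul_one] at h2
    refine h2.congr' ?_
    filter_upwards [eventually_ge_atTop (k+1)] with n hn
    have hn0 : (n : ℝ) ≠ 0 := by
      have : n ≠ 0 := by omega
      exact_mod_cast this
    rw [Nat.descFactorial_succ, Nat.cast_mul, Nat.cast_sub (by omega)]
    field_simp
    ring

lemma T_nonneg (n m e j : ℕ) : 0 ≤ T n m e j := by
  unfold T
  have := pr_nonneg ((n+1)*(m+1)) e (2*(j+2))
  positivity

lemma T_le (n m e j : ℕ) (he : e ≤ (n+1)*(m+1)) :
    T n m e j ≤ ((e:ℝ)^2 / ((n+1)*(m+1))) ^ (j+2) := by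
  have h0 := pr_nonneg ((n+1)*(m+1)) e (2*(j+2))
  have h1 : ((n+1).descFactorial (j+2) : ℝ) ≤ ((n:ℝ)+1)^(j+2) := by
    exact_mod_cast Nat.descFactorial_le_pow (n+1) (j+2)
  have h2 : ((m+1).descFactorial (j+2) : ℝ) ≤ ((m:ℝ)+1)^(j+2) := by
    exact_mod_cast Nat.descFactorial_le_pow (m+1) (j+2)
  have h3 := pr_le ((n+1)*(m+1)) e (2*(j+2)) he
  unfold T
  calc _ ≤ ((n+1).descFactorial (j+2) : ℝ) * ((m+1).descFactorial (j+2) : ℝ) *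
        pr ((n+1)*(m+1)) e (2*(j+2)) := by
        apply mul_le_mul_of_nonneg_right _ h0
        apply div_le_self (by positivity)
        have : (0:ℝ) ≤ j := by positivity
        linarith
    _ ≤ ((n:ℝ)+1)^(j+2) * ((m:ℝ)+1)^(j+2) * ((e : ℝ) / (((n+1)*(m+1) : ℕ) : ℝ)) ^ (2*(j+2)) := by
        gcongr
    _ = _ := by
        push_cast
        rw [pow_mul, ← mul_pow, ← mul_pow]
        congr 1
        field_simp

lemma T_tendsto (n m e : ℕ → ℕ)
    (hn : Tendsto n atTop atTop) (hm : Tendsto m atTop atTop) (he : Tendsto e atTop atTop)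
    (x : ℝ) 
    (hcrit : Tendsto (fun k => ((e k : ℝ) ^ 2 / ((n k + 1) * (m k + 1)))) atTop (nhds x)) (j : ℕ) :
    Tendsto (fun k => T (n k) (m k) (e k) j) atTop (𝓝 (x^(j+2) / (2*(j+2)))) := by
  have hn1 : Tendsto (fun k => n k + 1) atTop atTop := tendsto_atTop_mono (fun k => Nat.le_succ _) hn
  have hm1 : Tendsto (fun k => m k + 1) atTop atTop := tendsto_atTop_mono (fun k => Nat.le_succ _) hm
  have hN : Tendsto (fun k => (n k + 1) * (m k + 1)) atTop atTop := hn1.atTop_mul_atTop₀ hm1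
  have a1 := (tendsto_descFact (j+2)).comp hn1
  have a2 := (tendsto_descFact (j+2)).comp hm1
  have a3 := (tendsto_descFact (2*(j+2))).comp he
  have a4 := (tendsto_descFact (2*(j+2))).comp hN
  have a5 := hcrit.pow (j+2)
  have h := ((((a1.mul a2).mul a3).div a4 one_ne_zero).mul a5).div_const (2*((j:ℝ)+2))
  simp only [mul_one, div_one, one_mul] at h
  refine h.congr' ?_
  filter_upwards [he.eventually_ge_atTop 1] with k hk
  have he0 : (e k : ℝ) ≠ 0 := by
    have : e k ≠ 0 := by omega
    exact_mod_cast this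
  simp only [Function.comp, T, pr, Pi.div_apply]
  push_cast
  have hn0 : ((n k : ℝ) + 1) ≠ 0 := by positivity
  have hm0 : ((m k : ℝ) + 1) ≠ 0 := by positivity
  have e1 : ((e k : ℝ) ^ 2 / ((n k + 1) * (m k + 1))) ^ (j+2) =
    (e k : ℝ)^(2*(j+2)) * (((n k : ℝ) + 1)^(j+2) * ((m k : ℝ) + 1)^(j+2)) /
      ((((n k : ℝ) + 1) * ((m k : ℝ) + 1)) ^ (2*(j+2))) := by
    rw [div_pow, ← pow_mul, ← mul_pow, mul_comm 2 (j+2), pow_mul (((n k : ℝ) + 1) * _)]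
    field_simp
  rw [e1]
  have b1 := pow_ne_zero (j+2) hn0
  have b2 := pow_ne_zero (j+2) hm0
  have b3 := pow_ne_zero (2*(j+2)) he0
  have b4 := pow_ne_zero (2*(j+2)) (mul_ne_zero hn0 hm0)
  generalize ((n k : ℝ) + 1)^(j+2) = u1 at *
  generalize ((m k : ℝ) + 1)^(j+2) = u2 at *
  generalize (e k : ℝ)^(2*(j+2)) = u3 at *
  generalize (((n k : ℝ) + 1) * ((m k : ℝ) + 1)) ^ (2*(j+2)) = u4 at *
  by_cases hz : ((((n k + 1) * (m k + 1)).descFactorial (2*(j+2)) : ℕ) : ℝ) = 0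
  · rw [hz]; simp only [zero_div, div_zero, zero_mul, mul_zero]
  · field_simp

lemma limit_sum (x : ℝ) (hx : x ∈ Set.Ioo (0 : ℝ) 1) :
    HasSum (fun j : ℕ => x^(j+2) / (2*((j:ℝ)+2))) (-(Real.log (1 - x) + x) / 2) := by
  have h := Real.hasSum_pow_div_log_of_abs_lt_one (x := x) (by rw [abs_of_pos hx.1]; exact hx.2)
  have h1 := (hasSum_nat_add_iff' 1).2 h
  have h2 := h1.div_const 2
  have e1 : (fun j : ℕ => x^(j+2) / (2*((j:ℝ)+2))) =
      fun i : ℕ => x ^ (i + 1 + 1) / (((i + 1 : ℕ) : ℝ) + 1) / 2 := by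
    funext j
    push_cast
    rw [div_div]
    congr 1
    ring
  have e2 : -(Real.log (1 - x) + x) / 2 =
      (-Real.log (1 - x) - ∑ i ∈ Finset.range 1, x ^ (i + 1) / ((i : ℝ) + 1)) / 2 := by
    simp; ring
  rw [e1, e2]
  exact h2

end Asymp

/-- Expected bandwidth, critical regime: if `e_k = Θ(n_k) = Θ(m_k)` and
`e_k² / ((n_k+1)(m_k+1)) → x ∈ (0,1)`, the average of `I(E)` over all `e_k`-cell
configurations tends to `−(ln(1−x)+x)/2`. -/
theorem expected_bandwidth_critical (n m e : ℕ → ℕ)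
    (hn : Tendsto n atTop atTop) (hm : Tendsto m atTop atTop) (he : Tendsto e atTop atTop)
    (hpos : ∀ k, 0 < n k ∧ 0 < m k ∧ 0 < e k)
    (hle : ∀ k, e k ≤ (n k + 1) * (m k + 1))
    (a b : ℝ) (ha : 0 < a) (hab : a ≤ b)
    (hTheta : ∀ k, a * n k ≤ (e k : ℝ) ∧ (e k : ℝ) ≤ b * n k ∧
      a * m k ≤ (e k : ℝ) ∧ (e k : ℝ) ≤ b * m k)
    (x : ℝ) (hx : x ∈ Set.Ioo (0 : ℝ) 1)
    (hcrit : Tendsto (fun k => ((e k : ℝ) ^ 2 / ((n k + 1) * (m k + 1)))) atTop (nhds x)) :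
    Tendsto
      (fun k =>
        (∑ E ∈ Finset.powersetCard (e k)
            (Finset.univ : Finset (Fin (n k + 1) × Fin (m k + 1))),
            (minFRS (n k) (m k) E : ℝ)) /
          (Nat.choose ((n k + 1) * (m k + 1)) (e k) : ℝ))
      atTop (nhds (-(Real.log (1 - x) + x) / 2)) := by
  change Tendsto (fun k => avgI (n k) (m k) (e k)) atTop _
  have hsum := limit_sum x hx
  obtain ⟨y, hxy, hy1⟩ := exists_between hx.2
  have hy0 : 0 < y := hx.1.trans hxy
  have hup : Tendsto (fun k => ∑' j, T (n k) (m k) (e k) j) atTop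
      (𝓝 (-(Real.log (1 - x) + x) / 2)) := by
    rw [← hsum.tsum_eq]
    apply tendsto_tsum_of_dominated_convergence (bound := fun j : ℕ => y ^ (j+2))
    · exact (summable_nat_add_iff 2).2 (summable_geometric_of_lt_one hy0.le hy1)
    · intro j
      exact T_tendsto n m e hn hm he x hcrit j
    · filter_upwards [hcrit.eventually_lt_const hxy] with k hk j
      rw [Real.norm_of_nonneg (T_nonneg _ _ _ _)]
      refine (T_le _ _ _ _ (hle k)).trans ?_
      gcongr
  have hsummable : ∀ᶠ k in atTop, Summable (T (n k) (m k) (e k)) := by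
    filter_upwards [hcrit.eventually_lt_const hxy] with k hk
    apply Summable.of_nonneg_of_le (T_nonneg _ _ _) (f := fun j : ℕ => y ^ (j+2))
    · intro j
      refine (T_le _ _ _ _ (hle k)).trans ?_
      gcongr
    · exact (summable_nat_add_iff 2).2 (summable_geometric_of_lt_one hy0.le hy1)
  have hupper : ∀ᶠ k in atTop, avgI (n k) (m k) (e k) ≤ ∑' j, T (n k) (m k) (e k) j := by
    filter_upwards [hsummable] with k hk
    exact (avg_upper _ _ _ (hle k)).trans (hk.sum_le_tsum _ (fun j _ => T_nonneg _ _ _ _))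
  have hp0 : Tendsto (fun k => (e k : ℝ) / ((n k + 1) * (m k + 1))) atTop (𝓝 0) := by
    have h1 : Tendsto (fun k => ((e k : ℝ) ^ 2 / ((n k + 1) * (m k + 1))) * (1 / (e k : ℝ)))
        atTop (𝓝 (x * 0)) :=
      hcrit.mul (tendsto_one_div_atTop_nhds_zero_nat.comp he)
    rw [mul_zero] at h1
    refine h1.congr fun k => ?_
    have : (e k : ℝ) ≠ 0 := by exact_mod_cast (hpos k).2.2.ne'
    field_simp
  have hdense : ∀ K : ℕ, Tendsto (fun k => denseErr (n k) (m k) (e k) K) atTop (𝓝 0) := by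
    intro K
    set B := max b 1 with hB
    have h1 := hp0.const_mul (((4*K+5)^2 * 2 ^ ((4*K+4)^2) * B ^ (2*(4*K+4)) : ℝ))
    rw [mul_zero] at h1
    refine squeeze_zero (fun k => ?_) (fun k => ?_) h1
    · exact Finset.sum_nonneg fun F _ => pr_nonneg _ _ _
    · have hb0 : (0:ℝ) ≤ B := by positivity
      have hbB : b ≤ B := le_max_left _ _
      obtain ⟨_, h2, _, h3⟩ := hTheta k
      have hnk : (0:ℝ) ≤ n k := by positivity
      have hmk : (0:ℝ) ≤ m k := by positivity
      exact denseErr_le _ _ _ K (hle k) B (le_max_right _ _) (by nlinarith) (by nlinarith)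
  rw [tendsto_order]
  constructor
  · intro l hl
    obtain ⟨K, hK⟩ := (hsum.tendsto_sum_nat.eventually_const_lt hl).exists
    have h1 : Tendsto (fun k => ∑ j ∈ Finset.range K, T (n k) (m k) (e k) j -
        2 ^ (4*K+4) * denseErr (n k) (m k) (e k) K) atTop
        (𝓝 (∑ j ∈ Finset.range K, x^(j+2) / (2*((j:ℝ)+2)) - 2 ^ (4*K+4) * 0)) :=
      (tendsto_finsetSum _ fun j _ => T_tendsto n m e hn hm he x hcrit j).sub
        ((hdense K).const_mul _)
    rw [mul_zero, sub_zero] at h1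
    filter_upwards [h1.eventually_const_lt hK] with k hk
    exact hk.trans_le (avg_lower _ _ _ K (hle k))
  · intro u hu
    filter_upwards [hup.eventually_lt_const hu, hupper] with k h1 h2
    exact h2.trans_lt h1
end
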